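/- arXiv:1112.2632 — 2 statements merged into one kernel-verified Lean document; each statement's English description precedes it below -/
import Mathlib

section
/- Let H = (V, E) be a hypergraph whose associated bipartite graph bip H is connected. A function f : E → ℕ is a hypertree in H if and only if ∑_{e ∈ E} f(e) = |V| − 1 and for every nonempty proper subset E' ⊊ E one has ∑_{e ∈ E'} f(e) ≤ μ(E') = |⋃E'| − c(E'). In other words, the hypertrees are exactly the integer lattice points of the polytope cut out of the hyperplane {f : ∑_{e ∈ E} f(e) = |V| − 1} by these inequalities together with f ≥ 0. -/
open SimpleGraph

/-- The bipartite graph associated to a hypergraph with hyperedge set `E`,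
vertex set `V`, and incidence function `I`. -/
def bip {V E : Type*} (I : E → Finset V) : SimpleGraph (E ⊕ V) :=
  SimpleGraph.fromRel fun a b =>
    ∃ e v, a = Sum.inl e ∧ b = Sum.inr v ∧ v ∈ I e

/-- `f : E → ℕ` is a hypertree: there is a spanning tree of `bip I` whose
degree at each `e ∈ E` is `f e + 1`. -/
def IsHypertree {V E : Type*} (I : E → Finset V) (f : E → ℕ) : Prop :=
  ∃ T : SimpleGraph (E ⊕ V), T ≤ bip I ∧ T.IsTree ∧
    ∀ e : E, (T.neighborSet (Sum.inl e)).ncard = f e + 1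

/-- The vertex set `E' ⊔ ⋃ E'` of the restriction `bip H |_{E'}`. -/
def suppSet {V E : Type*} (I : E → Finset V) (E' : Finset E) : Set (E ⊕ V) :=
  (Sum.inl '' {e | e ∈ E'}) ∪ (Sum.inr '' {v | ∃ e ∈ E', v ∈ I e})

/-- `c(E')`: the number of connected components of the induced subgraph of
`bip I` on `E' ⊔ ⋃ E'`. -/
noncomputable def numComp {V E : Type*} (I : E → Finset V) (E' : Finset E) : ℕ :=
  Nat.card ((bip I).induce (suppSet I E')).ConnectedComponent

/-- `μ(E') = |⋃ E'| - c(E')`. -/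
noncomputable def mu {V E : Type*} [DecidableEq V] (I : E → Finset V)
    (E' : Finset E) : ℤ :=
  ((E'.biUnion I).card : ℤ) - numComp I E'

section Graph

variable {W : Type*} {G : SimpleGraph W}

/-- A forest has at least as many vertices as edges and components together. -/
theorem SimpleGraph.IsAcyclic.card_edgeSet_add_card_connectedComponent_le [Finite W]
    (hG : G.IsAcyclic) :
    Nat.card G.edgeSet + Nat.card G.ConnectedComponent ≤ Nat.card W := by
  induction hn : Nat.card G.edgeSet generalizing G with
  | zero =>
    rw [zero_add]
    exact Nat.card_le_card_of_surjective G.connectedComponentMk Quot.mk_surjective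
  | succ n ih =>
    obtain ⟨⟨e, he⟩⟩ : Nonempty G.edgeSet := (Nat.card_pos_iff.1 (by omega)).1
    induction e using Sym2.ind with
    | _ u v =>
    have hle : G.deleteEdges {s(u, v)} ≤ G := G.deleteEdges_le _
    have hcard : Nat.card (G.deleteEdges {s(u, v)}).edgeSet = n := by
      rw [Nat.card_coe_set_eq] at hn ⊢
      rw [edgeSet_deleteEdges, Set.ncard_sdiff_singleton_of_mem he, hn, Nat.add_sub_cancel]
    have hbridge : ¬ (G.deleteEdges {s(u, v)}).Reachable u v :=
      isBridge_iff.1 (isAcyclic_iff_forall_isBridge.1 hG he)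
    have hsurj := ConnectedComponent.surjective_map_ofLE hle
    have hlt : Nat.card G.ConnectedComponent <
        Nat.card (G.deleteEdges {s(u, v)}).ConnectedComponent := by
      refine lt_of_le_of_ne (Nat.card_le_card_of_surjective _ hsurj) fun heq => hbridge ?_
      have hbij := (Nat.bijective_iff_surjective_and_card _).2 ⟨hsurj, heq.symm⟩
      refine ConnectedComponent.exact (hbij.1 ?_)
      exact ConnectedComponent.sound (show G.Adj u v from he).reachable
    have := ih (hG.anti hle) hcard
    omega

/-- If every edge has exactly one end in the range of an injective family of vertices, then the
degrees of that family sum to the number of edges. -/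
theorem SimpleGraph.sum_ncard_neighborSet_eq_card_edgeSet [Finite W] {ι : Type*} [Fintype ι]
    {a : ι → W} (ha : Function.Injective a)
    (hG : ∀ x y, G.Adj x y → (x ∈ Set.range a ↔ y ∉ Set.range a)) :
    ∑ i, (G.neighborSet (a i)).ncard = Nat.card G.edgeSet := by
  simp_rw [← Nat.card_coe_set_eq]
  rw [← Nat.card_sigma]
  refine Nat.card_eq_of_bijective
    (fun p : Σ i, G.neighborSet (a i) => (⟨s(a p.1, p.2), p.2.2⟩ : G.edgeSet)) ⟨?_, ?_⟩
  · rintro ⟨i, y, hy⟩ ⟨j, z, hz⟩ h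
    rcases Sym2.eq_iff.1 (congrArg Subtype.val h) with ⟨hij, hyz⟩ | ⟨-, hyj⟩
    · obtain rfl := ha hij
      obtain rfl : y = z := hyz
      rfl
    · exact absurd ⟨j, hyj.symm⟩ ((hG _ _ hy).1 ⟨i, rfl⟩)
  · rintro ⟨e, he⟩
    induction e using Sym2.ind with
    | _ x y =>
    have he' : G.Adj x y := he
    by_cases hx : x ∈ Set.range a
    · obtain ⟨i, rfl⟩ := hx
      exact ⟨⟨i, y, he'⟩, rfl⟩
    · obtain ⟨i, rfl⟩ := not_not.1 fun hy => hx ((hG _ _ he').2 hy)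
      exact ⟨⟨i, x, he'.symm⟩, Subtype.ext Sym2.eq_swap⟩

end Graph

section Bip

variable {V E : Type*} {I : E → Finset V}

@[simp]
theorem bip_adj_inl_inr {e : E} {v : V} : (bip I).Adj (Sum.inl e) (Sum.inr v) ↔ v ∈ I e := by
  simp [bip]

@[simp]
theorem bip_adj_inr_inl {e : E} {v : V} : (bip I).Adj (Sum.inr v) (Sum.inl e) ↔ v ∈ I e := by
  simp [bip]

@[simp]
theorem not_bip_adj_inl_inl {e e' : E} : ¬ (bip I).Adj (Sum.inl e) (Sum.inl e') := by
  simp [bip]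

@[simp]
theorem not_bip_adj_inr_inr {v w : V} : ¬ (bip I).Adj (Sum.inr v) (Sum.inr w) := by
  simp [bip]

theorem mem_range_inl_iff_of_bip_adj {x y : E ⊕ V} (h : (bip I).Adj x y) :
    x ∈ Set.range (Sum.inl : E → E ⊕ V) ↔ y ∉ Set.range (Sum.inl : E → E ⊕ V) := by
  rcases x with e | v <;> rcases y with e' | w <;> simp_all

theorem bip_mono {J : E → Finset V} (h : ∀ e, J e ⊆ I e) : bip J ≤ bip I := by
  rintro (e | v) (e' | w) <;> simp <;> apply h

theorem ncard_neighborSet_bip (e : E) : ((bip I).neighborSet (Sum.inl e)).ncard = (I e).card := by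
  have : (bip I).neighborSet (Sum.inl e) = Sum.inr '' (I e : Set V) := by
    ext (e' | v) <;> simp
  rw [this, Set.ncard_image_of_injective _ Sum.inr_injective, Set.ncard_coe_finset]

theorem sum_ncard_neighborSet_of_le_bip [Fintype V] [Fintype E] {T : SimpleGraph (E ⊕ V)}
    (hT : T ≤ bip I) : ∑ e, (T.neighborSet (Sum.inl e)).ncard = Nat.card T.edgeSet :=
  sum_ncard_neighborSet_eq_card_edgeSet Sum.inl_injective fun _ _ h =>
    mem_range_inl_iff_of_bip_adj (hT h)

@[simp]
theorem inl_mem_suppSet {E' : Finset E} {e : E} : Sum.inl e ∈ suppSet I E' ↔ e ∈ E' := by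
  simp [suppSet]

@[simp]
theorem inr_mem_suppSet {E' : Finset E} {v : V} :
    Sum.inr v ∈ suppSet I E' ↔ ∃ e ∈ E', v ∈ I e := by
  simp [suppSet]

theorem card_suppSet [DecidableEq V] (E' : Finset E) :
    Nat.card (suppSet I E') = E'.card + (E'.biUnion I).card := by
  have : suppSet I E' = (E'.disjSum (E'.biUnion I) : Set (E ⊕ V)) := by
    ext (e | v) <;> simp
  rw [this, Nat.card_coe_set_eq, Set.ncard_coe_finset, Finset.card_disjSum]

theorem numComp_pos [Finite V] [Finite E] {E' : Finset E} (hE' : E'.Nonempty) :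
    0 < numComp I E' := by
  obtain ⟨e, he⟩ := hE'
  have : Nonempty (suppSet I E') := ⟨⟨Sum.inl e, inl_mem_suppSet.2 he⟩⟩
  exact Nat.card_pos

/-- An acyclic subgraph of `bip I` has at most `μ(E') + |E'|` edges at the hyperedges in `E'`. -/
theorem sum_ncard_neighborSet_le_of_isAcyclic [Fintype V] [Fintype E] [DecidableEq V]
    {T : SimpleGraph (E ⊕ V)} (hT : T ≤ bip I) (hac : T.IsAcyclic) (E' : Finset E) :
    ∑ e ∈ E', (T.neighborSet (Sum.inl e)).ncard + numComp I E' ≤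
      E'.card + (E'.biUnion I).card := by
  let a : E' → suppSet I E' := fun e => ⟨Sum.inl e, inl_mem_suppSet.2 e.2⟩
  have ha : Function.Injective a := fun e e' h =>
    Subtype.ext (Sum.inl_injective (congrArg Subtype.val h))
  have hrange (x : suppSet I E') :
      x ∈ Set.range a ↔ (x : E ⊕ V) ∈ Set.range (Sum.inl : E → E ⊕ V) := by
    constructor
    · rintro ⟨e, rfl⟩
      exact ⟨e, rfl⟩
    · obtain ⟨x, hx⟩ := x
      rintro ⟨e, rfl⟩
      exact ⟨⟨e, inl_mem_suppSet.1 hx⟩, rfl⟩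
  have hdeg (e : E') : ((T.induce (suppSet I E')).neighborSet (a e)).ncard =
      (T.neighborSet (Sum.inl e.1)).ncard := by
    rw [← Set.ncard_image_of_injective _ Subtype.val_injective]
    congr 1
    ext y
    constructor
    · rintro ⟨z, hz, rfl⟩
      exact hz
    · intro hy
      have hy' := hT hy
      rcases y with e' | v
      · simp at hy'
      · exact ⟨⟨Sum.inr v, inr_mem_suppSet.2 ⟨e, e.2, bip_adj_inl_inr.1 hy'⟩⟩, hy, rfl⟩
  have hsum : ∑ e ∈ E', (T.neighborSet (Sum.inl e)).ncard =
      Nat.card (T.induce (suppSet I E')).edgeSet := by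
    rw [← sum_ncard_neighborSet_eq_card_edgeSet ha, ← Finset.sum_coe_sort]
    · exact Finset.sum_congr rfl fun e _ => (hdeg e).symm
    · intro x y h
      rw [hrange, hrange]
      exact mem_range_inl_iff_of_bip_adj (hT h)
  have hforest := (hac.induce (suppSet I E')).card_edgeSet_add_card_connectedComponent_le
  have hcomp : numComp I E' ≤ Nat.card (T.induce (suppSet I E')).ConnectedComponent :=
    Nat.card_le_card_of_surjective _
      (ConnectedComponent.surjective_map_ofLE (comap_monotone _ hT))
  rw [← card_suppSet, hsum]
  omega

theorem IsHypertree.sum_eq [Fintype V] [Fintype E] {f : E → ℕ} (hf : IsHypertree I f) :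
    ∑ e, f e + 1 = Fintype.card V := by
  obtain ⟨T, hT, htree, hdeg⟩ := hf
  have h := (isTree_iff_connected_and_card.1 htree).2
  rw [← sum_ncard_neighborSet_of_le_bip hT] at h
  simp only [hdeg, Finset.sum_add_distrib, Finset.sum_const, Finset.card_univ,
    Nat.card_eq_fintype_card, Fintype.card_sum, smul_eq_mul, mul_one] at h
  omega

theorem IsHypertree.sum_le_mu [Fintype V] [Fintype E] [DecidableEq V] {f : E → ℕ}
    (hf : IsHypertree I f) (E' : Finset E) : ∑ e ∈ E', (f e : ℤ) ≤ mu I E' := by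
  obtain ⟨T, hT, htree, hdeg⟩ := hf
  have h := sum_ncard_neighborSet_le_of_isAcyclic hT htree.isAcyclic E'
  simp only [hdeg, Finset.sum_add_distrib, Finset.sum_const, smul_eq_mul, mul_one] at h
  rw [mu, ← Nat.cast_sum]
  omega

theorem biUnion_univ_eq_univ_of_connected [Fintype V] [Fintype E] [Nonempty E] [DecidableEq V]
    (hconn : (bip I).Connected) : Finset.univ.biUnion I = Finset.univ := by
  refine Finset.eq_univ_of_forall fun v => ?_
  have : Nontrivial (E ⊕ V) :=
    ⟨Sum.inl (Classical.arbitrary E), Sum.inr v, Sum.inl_ne_inr⟩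
  obtain ⟨e | w, h⟩ := hconn.preconnected.exists_adj_of_nontrivial (Sum.inr v)
  · exact Finset.mem_biUnion.2 ⟨e, Finset.mem_univ e, bip_adj_inr_inl.1 h⟩
  · simp at h

/-- By Hall's theorem, the vertices other than `v₀` can be distributed among the hyperedges so
that each hyperedge `e` receives `f e` of its vertices. -/
theorem exists_pairwise_disjoint_card_eq [Fintype V] [Fintype E] [DecidableEq V] {f : E → ℕ}
    (hsum : ∑ e, f e + 1 = Fintype.card V)
    (hlt : ∀ E' : Finset E, E'.Nonempty → ∑ e ∈ E', f e < (E'.biUnion I).card) (v₀ : V) :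
    ∃ C : E → Finset V, (∀ e, C e ⊆ I e) ∧ (∀ e, (C e).card = f e) ∧ (∀ e, v₀ ∉ C e) ∧
      (∀ v ≠ v₀, ∃ e, v ∈ C e) ∧ Pairwise (Function.onFun Disjoint C) := by
  classical
  have hall (s : Finset (Σ e, Fin (f e))) :
      s.card ≤ (s.biUnion fun p => (I p.1).erase v₀).card := by
    rcases s.eq_empty_or_nonempty with rfl | hs
    · simp
    have hE := hlt (s.image Sigma.fst) (hs.image _)
    have hcard : s.card ≤ ∑ e ∈ s.image Sigma.fst, f e := by
      calc s.card ≤ ((s.image Sigma.fst).sigma fun e => (Finset.univ : Finset (Fin (f e)))).card :=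
            Finset.card_le_card fun p hp => by
              simpa using ⟨p.2, hp⟩
        _ = _ := by simp
    have herase : (s.biUnion fun p => (I p.1).erase v₀) =
        ((s.image Sigma.fst).biUnion I).erase v₀ := by
      ext v
      simp only [Finset.mem_biUnion, Finset.mem_erase, Finset.mem_image]
      grind
    rw [herase]
    have := Finset.pred_card_le_card_erase (s := (s.image Sigma.fst).biUnion I) (a := v₀)
    omega
  obtain ⟨φ, hφ, hmem⟩ := (Finset.all_card_le_biUnion_card_iff_exists_injective _).1 hall
  have hcover : Finset.univ.image φ = Finset.univ.erase v₀ := by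
    refine Finset.eq_of_subset_of_card_le (fun v hv => ?_) ?_
    · obtain ⟨p, -, rfl⟩ := Finset.mem_image.1 hv
      exact Finset.mem_erase.2 ⟨Finset.ne_of_mem_erase (hmem p), Finset.mem_univ _⟩
    · rw [Finset.card_image_of_injective _ hφ, Finset.card_erase_of_mem (Finset.mem_univ _)]
      simp
      omega
  refine ⟨fun e => Finset.univ.image fun i => φ ⟨e, i⟩, fun e v hv => ?_, fun e => ?_,
    fun e he => ?_, fun v hv => ?_, fun e e' hee' => ?_⟩
  · obtain ⟨i, -, rfl⟩ := Finset.mem_image.1 hv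
    exact Finset.mem_of_mem_erase (hmem ⟨e, i⟩)
  · exact (Finset.card_image_of_injective _ (hφ.comp sigma_mk_injective)).trans (by simp)
  · obtain ⟨i, -, hi⟩ := Finset.mem_image.1 he
    exact Finset.ne_of_mem_erase (hmem ⟨e, i⟩) hi
  · have : v ∈ Finset.univ.image φ := by
      rw [hcover]
      exact Finset.mem_erase.2 ⟨hv, Finset.mem_univ v⟩
    obtain ⟨⟨e, i⟩, -, rfl⟩ := Finset.mem_image.1 this
    exact ⟨e, Finset.mem_image_of_mem _ (Finset.mem_univ i)⟩
  · refine Finset.disjoint_left.2 fun v hv hv' => hee' ?_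
    obtain ⟨i, -, rfl⟩ := Finset.mem_image.1 hv
    obtain ⟨j, -, hj⟩ := Finset.mem_image.1 hv'
    exact (congrArg Sigma.fst (hφ hj)).symm

/-- The hyperedges reached from `v₀` within `n` rounds, where a reached hyperedge `e` passes on
the vertices in `C e`. -/
def reachedWithin (I C : E → Finset V) (v₀ : V) : ℕ → Set E
  | 0 => ∅
  | n + 1 => {e | ∃ v ∈ I e, v = v₀ ∨ ∃ e' ∈ reachedWithin I C v₀ n, v ∈ C e'}

theorem exists_mem_reachedWithin [Fintype V] [Fintype E] [DecidableEq V] {f : E → ℕ}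
    {C : E → Finset V} {v₀ : V}
    (hlt : ∀ E' : Finset E, E'.Nonempty → ∑ e ∈ E', f e < (E'.biUnion I).card)
    (hcard : ∀ e, (C e).card = f e) (hcover : ∀ v ≠ v₀, ∃ e, v ∈ C e) (e : E) :
    ∃ n, e ∈ reachedWithin I C v₀ n := by
  classical
  by_contra he
  let R : Finset E := {e | ∀ n, e ∉ reachedWithin I C v₀ n}
  have hR : R.Nonempty := ⟨e, by simpa [R] using he⟩
  have hsub : R.biUnion I ⊆ R.biUnion C := by
    intro v hv
    obtain ⟨r, hr, hvr⟩ := Finset.mem_biUnion.1 hv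
    have hr' (n : ℕ) := (Finset.mem_filter.1 hr).2 n
    have hv₀ : v ≠ v₀ := fun h => hr' 1 ⟨v, hvr, Or.inl h⟩
    obtain ⟨e', he'⟩ := hcover v hv₀
    refine Finset.mem_biUnion.2 ⟨e', Finset.mem_filter.2 ⟨Finset.mem_univ _, fun n hn => ?_⟩, he'⟩
    exact hr' (n + 1) ⟨v, hvr, Or.inr ⟨e', hn, he'⟩⟩
  have h₁ := (Finset.card_le_card hsub).trans Finset.card_biUnion_le
  simp only [hcard] at h₁
  exact (hlt R hR).not_ge h₁

theorem isHypertree_of_sum_lt_card_biUnion [Fintype V] [Fintype E] [DecidableEq V] {f : E → ℕ}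
    (hsum : ∑ e, f e + 1 = Fintype.card V)
    (hlt : ∀ E' : Finset E, E'.Nonempty → ∑ e ∈ E', f e < (E'.biUnion I).card) :
    IsHypertree I f := by
  classical
  obtain ⟨v₀⟩ : Nonempty V := Fintype.card_pos_iff.1 (by omega)
  obtain ⟨C, hCI, hcard, hv₀, hcover, hdisj⟩ := exists_pairwise_disjoint_card_eq hsum hlt v₀
  have hreach := exists_mem_reachedWithin hlt hcard hcover
  let rank (e : E) : ℕ := Nat.find (hreach e)
  have hparent (e : E) : ∃ v ∈ I e, v = v₀ ∨ ∃ e', rank e' < rank e ∧ v ∈ C e' := by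
    have hspec := Nat.find_spec (hreach e)
    obtain ⟨n, hn⟩ : ∃ n, rank e = n + 1 := Nat.exists_eq_succ_of_ne_zero fun h0 => by
      change e ∈ reachedWithin I C v₀ (rank e) at hspec
      rw [h0] at hspec
      exact hspec
    change e ∈ reachedWithin I C v₀ (rank e) at hspec
    rw [hn] at hspec
    obtain ⟨v, hv, h⟩ := hspec
    refine ⟨v, hv, h.imp_right ?_⟩
    rintro ⟨e', he', hve'⟩
    exact ⟨e', hn ▸ Nat.lt_succ_of_le (Nat.find_min' (hreach e') he'), hve'⟩
  choose p hpI hp using hparent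
  have hpC (e : E) : p e ∉ C e := fun h => by
    rcases hp e with h0 | ⟨e', hlt', he'⟩
    · exact hv₀ e (h0 ▸ h)
    · have hne : e' ≠ e := fun heq => hlt'.ne (congrArg rank heq)
      exact Finset.disjoint_left.1 (hdisj hne) he' h
  let J (e : E) : Finset V := insert (p e) (C e)
  have hJcard (e : E) : (J e).card = f e + 1 := by
    rw [Finset.card_insert_of_notMem (hpC e), hcard]
  have hJI : bip J ≤ bip I := bip_mono fun e => Finset.insert_subset (hpI e) (hCI e)
  have hchild {e : E} {v : V} (h : v ∈ J e) : (bip J).Reachable (Sum.inl e) (Sum.inr v) :=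
    (bip_adj_inl_inr.2 h).reachable
  have hE (e : E) : (bip J).Reachable (Sum.inl e) (Sum.inr v₀) := by
    induction hn : rank e using Nat.strong_induction_on generalizing e with
    | _ n ih =>
    have hstep := hchild (Finset.mem_insert_self (p e) (C e))
    rcases hp e with h0 | ⟨e', hlt', he'⟩
    · rwa [h0] at hstep
    · exact hstep.trans
        ((hchild (Finset.mem_insert_of_mem he')).symm.trans (ih _ (hn ▸ hlt') e' rfl))
  have hroot (x : E ⊕ V) : (bip J).Reachable x (Sum.inr v₀) := by
    rcases x with e | v
    · exact hE e
    · by_cases hv : v = v₀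
      · rw [hv]
      · obtain ⟨e, he⟩ := hcover v hv
        exact (hchild (Finset.mem_insert_of_mem he)).symm.trans (hE e)
  have hconn : (bip J).Connected :=
    { preconnected := fun x y => (hroot x).trans (hroot y).symm
      nonempty := ⟨Sum.inr v₀⟩ }
  refine ⟨bip J, hJI, isTree_iff_connected_and_card.2 ⟨hconn, ?_⟩, fun e => ?_⟩
  · rw [← sum_ncard_neighborSet_of_le_bip le_rfl]
    simp only [ncard_neighborSet_bip, hJcard, Finset.sum_add_distrib, Finset.sum_const,
      Finset.card_univ, Nat.card_eq_fintype_card, Fintype.card_sum, smul_eq_mul, mul_one]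
    omega
  · rw [ncard_neighborSet_bip, hJcard]

end Bip

/-- A function `f : E → ℕ` is a hypertree if and only if
`∑ e, f e = |V| - 1` and `∑_{e ∈ E'} f e ≤ μ(E')` for every nonempty proper
subset `E' ⊊ E`. -/
theorem isHypertree_iff {V E : Type*} [Fintype V] [Fintype E] [DecidableEq V]
    (I : E → Finset V) (hne : ∀ e, (I e).Nonempty) (hconn : (bip I).Connected)
    (f : E → ℕ) :
    IsHypertree I f ↔
      (∑ e, (f e : ℤ)) = (Fintype.card V : ℤ) - 1 ∧
      ∀ E' : Finset E, E'.Nonempty → E' ≠ Finset.univ →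
        (∑ e ∈ E', (f e : ℤ)) ≤ mu I E' := by
  refine ⟨fun hf => ⟨?_, fun E' _ _ => hf.sum_le_mu E'⟩, fun ⟨hsum, hle⟩ => ?_⟩
  · have := hf.sum_eq
    rw [← Nat.cast_sum]
    omega
  · rw [← Nat.cast_sum] at hsum
    refine isHypertree_of_sum_lt_card_biUnion (by omega) fun E' hE' => ?_
    by_cases huniv : E' = Finset.univ
    · obtain ⟨e, -⟩ := hE'
      have : Nonempty E := ⟨e⟩
      rw [huniv, biUnion_univ_eq_univ_of_connected hconn, Finset.card_univ]
      omega
    · have h := hle E' hE' huniv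
      have hpos := numComp_pos (I := I) hE'
      rw [mu, ← Nat.cast_sum] at h
      omega
end

section
/- Let G be a connected finite bipartite graph with color classes V and E, inducing the hypergraph (V, E) (vertex set V, hyperedge set E) and its abstract dual (E, V) (vertex set E, hyperedge set V), both with associated bipartite graph G. Then the number of hypertrees of the two hypergraphs is the same: |Q_{(V,E)}| = |Q_{(E,V)}|. -/
open SimpleGraph

/-- `g : V → ℕ` is a hypertree of the abstract dual hypergraph `(E, V)` induced
by `G`: there is a spanning tree of `G` whose degree at each `v ∈ V` is
`g v + 1`. -/
def IsHypertreeDual {V E : Type*} (I : E → Finset V) (g : V → ℕ) : Prop :=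
  ∃ T : SimpleGraph (E ⊕ V), T ≤ bip I ∧ T.IsTree ∧
    ∀ v : V, (T.neighborSet (Sum.inr v)).ncard = g v + 1

namespace SimpleGraph

variable {W : Type*} {G T T' : SimpleGraph W} {A : Finset W}

/-- A property inherited along edges of a connected graph holds everywhere if it holds
somewhere. -/
lemma Connected.forall_of_adj (hT : T.Connected) {P : W → Prop} {x₀ : W} (h₀ : P x₀)
    (h : ∀ x y, T.Adj x y → P x → P y) (y : W) : P y := by
  obtain ⟨p⟩ := hT.preconnected x₀ y
  induction p with
  | nil => exact h₀
  | cons hadj _ ih => exact ih (h _ _ hadj h₀)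

lemma IsBipartiteWith.anti {s t : Set W} (hG : G.IsBipartiteWith s t) (hTG : T ≤ G) :
    T.IsBipartiteWith s t :=
  ⟨hG.disjoint, fun _ _ h => hG.mem_of_adj (hTG h)⟩

lemma IsBipartiteWith.mem_iff_notMem (hG : G.IsBipartiteWith A (A : Set W)ᶜ) {a b : W}
    (h : G.Adj a b) : a ∈ A ↔ b ∉ A := by
  have := hG.mem_of_adj h
  simp only [Finset.mem_coe, Set.mem_compl_iff] at this
  tauto

/-- In a component of a bipartite forest, the degrees in one color class count the edges. -/
lemma IsAcyclic.sum_ncard_neighborSet_add_one [Fintype W] [DecidableEq W] (hT : T.IsAcyclic)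
    (hA : T.IsBipartiteWith A (A : Set W)ᶜ) (C : T.ConnectedComponent) {K : Finset W}
    (hK : ∀ x, x ∈ K ↔ x ∈ C.supp) :
    ∑ a ∈ K with a ∈ A, (T.neighborSet a).ncard + 1 = K.card := by
  classical
  have htree := hT.isTree_connectedComponent C
  have hcard := htree.card_edgeFinset
  have hbip : C.toSimpleGraph.IsBipartiteWith
      (Finset.univ.filter fun x : C => x.1 ∈ A : Finset C)
      (Finset.univ.filter fun x : C => x.1 ∉ A : Finset C) := by
    refine ⟨?_, fun v w h => ?_⟩
    · rw [Finset.disjoint_coe]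
      exact Finset.disjoint_filter_filter_not _ _ _
    · have h' : T.Adj v.1 w.1 := h
      have := hA.mem_iff_notMem h'
      simp only [Finset.coe_filter, Finset.mem_univ, true_and, Set.mem_ofPred_eq]
      tauto
  rw [← isBipartiteWith_sum_degrees_eq_card_edges hbip] at hcard
  have hC : Fintype.card C = K.card := by
    refine Fintype.card_of_subtype K fun x => ?_
    rw [hK]
    rfl
  rw [← hC, ← hcard]
  congr 1
  symm
  refine Finset.sum_bij (fun x _ => x.1) ?_ ?_ ?_ ?_
  · intro x hx
    simp only [Finset.mem_filter, Finset.mem_univ, true_and] at hx ⊢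
    exact ⟨(hK _).2 x.2, hx⟩
  · intro x _ y _ h
    exact Subtype.ext h
  · intro x hx
    simp only [Finset.mem_filter] at hx
    exact ⟨⟨x, (hK _).1 hx.1⟩, by simpa using hx.2, rfl⟩
  · intro x _
    rw [← card_neighborSet_eq_degree, ← Nat.card_eq_fintype_card, Nat.card_coe_set_eq,
      ← Set.ncard_image_of_injective _ Subtype.val_injective]
    congr 1
    ext y
    simp only [Set.mem_image, mem_neighborSet, Subtype.exists, exists_and_right, exists_eq_right]
    constructor
    · rintro ⟨_, h⟩
      exact h
    · intro h
      have hx : x.1 ∈ C.supp := x.2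
      exact ⟨(C.mem_supp_congr_adj h).1 hx, h⟩

/-- The alternating sum of the edge weights along a walk. -/
def Walk.alternatingSum (w : Sym2 W → ℝ) : ∀ {u v : W}, T.Walk u v → ℝ
  | _, _, .nil => 0
  | _, _, .cons (u := u) (v := v) _ p => w s(u, v) - p.alternatingSum w

/-- On a tree every edge weighting is realised by vertex potentials. -/
lemma IsTree.exists_potential (hT : T.IsTree) (w : Sym2 W → ℝ) :
    ∃ π : W → ℝ, ∀ a b, T.Adj a b → π a + π b = w s(a, b) := by
  have := hT.connected.nonempty
  obtain ⟨r⟩ := this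
  choose p hp huniq using fun x => hT.existsUnique_path x r
  have key : ∀ a b, T.Adj a b → a ∉ (p b).support →
      (p a).alternatingSum w + (p b).alternatingSum w = w s(a, b) := by
    intro a b h hab
    rw [← huniq a (Walk.cons h (p b)) ((hp b).cons hab)]
    simp [Walk.alternatingSum]
  refine ⟨fun x => (p x).alternatingSum w, fun a b h => ?_⟩
  by_cases hab : a ∈ (p b).support
  · have := hT.isAcyclic.ne_mem_support_of_support_of_adj_of_isPath (hp b).reverse (hp a).reverse
      h.symm (by simpa using hab)
    simp only [Walk.support_reverse, List.mem_reverse] at this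
    rw [add_comm, key b a h.symm this, Sym2.eq_swap]
  · exact key a b h hab

/-- `T` is a spanning tree of `G` which is exactly the set of edges made tight by a feasible
solution of the dual of the transportation problem with costs `w`. -/
def IsTightTree (G : SimpleGraph W) (w : Sym2 W → ℝ) (T : SimpleGraph W) : Prop :=
  T ≤ G ∧ T.IsTree ∧ ∃ π : W → ℝ, ∀ a b, G.Adj a b →
    π a + π b ≤ w s(a, b) ∧ (π a + π b = w s(a, b) ↔ T.Adj a b)

/-- Tight trees are determined by their degrees in one color class. -/
lemma IsTightTree.eq_of_ncard_neighborSet_eq [Finite W] {w : Sym2 W → ℝ}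
    (hG : G.IsBipartiteWith A (A : Set W)ᶜ) (hT : G.IsTightTree w T) (hT' : G.IsTightTree w T')
    (h : ∀ a ∈ A, (T.neighborSet a).ncard = (T'.neighborSet a).ncard) : T = T' := by
  classical
  obtain ⟨hTG, hTtree, π, hπ⟩ := hT
  obtain ⟨hTG', hTtree', π', hπ'⟩ := hT'
  have := hTtree.connected.nonempty
  let g : W → ℝ := fun x => if x ∈ A then π' x - π x else π x - π' x
  obtain ⟨m, hm⟩ := Finite.exists_min g
  have hgA : ∀ {x}, x ∈ A → g x = π' x - π x := fun hx => by simp [g, hx]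
  have hgB : ∀ {x}, x ∉ A → g x = π x - π' x := fun hx => by simp [g, hx]
  have step : ∀ x y, T.Adj x y → g x = g m → g y = g m ∧ T'.Adj x y := by
    intro x y hxy hx
    by_cases hxA : x ∈ A
    · have hsub : T'.neighborSet x ⊆ T.neighborSet x := by
        intro z hz
        rw [mem_neighborSet] at hz ⊢
        have hadj := hTG' hz
        have hzA := (hG.mem_iff_notMem hadj).1 hxA
        have h1 := ((hπ' _ _ hadj).2).2 hz
        have h2 := (hπ _ _ hadj).1
        have h3 := hm z
        rw [← hx, hgA hxA, hgB hzA] at h3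
        exact ((hπ _ _ hadj).2).1 (by linarith)
      have heq := Set.eq_of_subset_of_ncard_le hsub (h x hxA).le
      have hxy' : T'.Adj x y := by
        rw [← mem_neighborSet, heq]
        exact hxy
      have hyA := (hG.mem_iff_notMem (hTG hxy)).1 hxA
      refine ⟨?_, hxy'⟩
      have h1 := ((hπ _ _ (hTG hxy)).2).2 hxy
      have h2 := ((hπ' _ _ (hTG hxy)).2).2 hxy'
      rw [← hx, hgA hxA, hgB hyA]
      linarith
    · have hyA : y ∈ A := (hG.mem_iff_notMem (hTG hxy).symm).2 hxA
      have h1 := ((hπ _ _ (hTG hxy)).2).2 hxy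
      have h2 := (hπ' _ _ (hTG hxy)).1
      have h3 := hm y
      rw [← hx, hgB hxA, hgA hyA] at h3
      refine ⟨?_, ((hπ' _ _ (hTG hxy)).2).1 (by linarith)⟩
      rw [← hx, hgB hxA, hgA hyA]
      linarith
  have hall := hTtree.connected.forall_of_adj (P := fun x => g x = g m) rfl
    fun x y hxy hx => (step x y hxy hx).1
  refine le_antisymm (fun x y hxy => (step x y hxy (hall x)).2) fun x y hxy => ?_
  have hadj := hTG' hxy
  have h1 := ((hπ' _ _ hadj).2).2 hxy
  refine ((hπ _ _ hadj).2).1 ?_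
  have h2 := hall x
  rw [← hall y] at h2
  by_cases hxA : x ∈ A
  · rw [hgA hxA, hgB ((hG.mem_iff_notMem hadj).1 hxA)] at h2
    linarith
  · rw [hgB hxA, hgA ((hG.mem_iff_notMem hadj.symm).2 hxA)] at h2
    linarith

/-- If the weights are linearly independent over `ℚ`, potentials of a connected graph are tight
on no further edge between the color classes. -/
lemma Connected.adj_of_potential_eq (hT : T.Connected) (hA : T.IsBipartiteWith A (A : Set W)ᶜ)
    {w : Sym2 W → ℝ} (hw : LinearIndependent ℚ w) {π : W → ℝ}
    (hπ : ∀ a b, T.Adj a b → π a + π b = w s(a, b)) {a b : W} (ha : a ∈ A) (hb : b ∉ A)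
    (hab : π a + π b = w s(a, b)) : T.Adj a b := by
  classical
  by_contra hadj
  have hnot := hw.notMem_span_image (s := T.edgeSet) (x := s(a, b)) (by simpa using hadj)
  let S := Submodule.span ℚ (w '' T.edgeSet)
  have hmem : ∀ x y, T.Adj x y → w s(x, y) ∈ S := fun x y h =>
    Submodule.subset_span ⟨s(x, y), by simpa using h, rfl⟩
  have hall := hT.forall_of_adj (x₀ := b)
    (P := fun x => (if x ∈ A then π x + π b else π b - π x) ∈ S) (by simp [hb]) ?_ a
  · simp only [ha, if_true, hab] at hall
    exact hnot hall
  · intro x y hxy hx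
    have h1 := hmem x y hxy
    rw [← hπ x y hxy] at h1
    by_cases hxA : x ∈ A
    · have hyA := (hA.mem_iff_notMem hxy).1 hxA
      simp only [hxA, hyA, if_true, if_false] at hx ⊢
      convert! S.sub_mem hx h1 using 1
      ring
    · have hyA := (hA.mem_iff_notMem hxy.symm).2 hxA
      simp only [hxA, hyA, if_true, if_false] at hx ⊢
      convert! S.add_mem hx h1 using 1
      ring

/-- Replacing an edge of a tree by another edge across the same cut yields a tree. -/
lemma IsTree.isTree_deleteEdges_sup_edge (hT : T.IsTree) {e u v : W} (heu : T.Adj e u)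
    (hev : e ≠ v) (huv : (T.deleteEdges {s(e, u)}).Reachable u v) :
    (T.deleteEdges {s(e, u)} ⊔ edge e v).IsTree := by
  have hbr : ¬ (T.deleteEdges {s(e, u)}).Reachable e u :=
    (isAcyclic_iff_forall_adj_isBridge.1 hT.isAcyclic) heu
  have hac : (T.deleteEdges {s(e, u)}).IsAcyclic := hT.isAcyclic.anti (deleteEdges_le _)
  refine ⟨?_, hac.sup_edge_of_not_reachable fun h => hbr (h.trans huv.symm)⟩
  set T₁ := T.deleteEdges {s(e, u)} ⊔ edge e v with hT₁
  have hle : T.deleteEdges {s(e, u)} ≤ T₁ := le_sup_left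
  have h1 : T₁.Reachable e v := by
    refine Adj.reachable ?_
    simp [hT₁, edge_adj, hev]
  have h2 : T₁.Reachable e u := h1.trans (huv.mono hle).symm
  have := hT.connected.nonempty
  refine (connected_iff_exists_forall_reachable _).2 ⟨e, ?_⟩
  refine hT.connected.forall_of_adj (P := T₁.Reachable e) (Reachable.refl e) fun x y hxy hx => ?_
  by_cases hs : s(x, y) = s(e, u)
  · rcases Sym2.eq_iff.1 hs with ⟨-, rfl⟩ | ⟨-, rfl⟩
    · exact h2
    · exact Reachable.refl _
  · refine hx.trans (Adj.reachable (hle ?_))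
    rw [deleteEdges_adj]
    exact ⟨hxy, by simpa using hs⟩

section Objective

variable [DecidableEq W] (A) (d : W → ℕ)

/-- The margins of the transportation problem associated to prescribed degrees `d` on `A`. -/
def margin (x : W) : ℝ := if x ∈ A then A.card * (d x - 1) + 1 else A.card

/-- The objective function of the dual of the transportation problem with margins `margin A d`. -/
def dualObjective [Fintype W] (π : W → ℝ) : ℝ := ∑ x, margin A d x * π x

/-- The sign distinguishing the color classes. -/
def colorSign (x : W) : ℝ := if x ∈ A then 1 else -1

variable {A d}

lemma sum_margin_mul_colorSign {K : Finset W} (hK : ∑ a ∈ K with a ∈ A, d a + 1 = K.card) :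
    ∑ x ∈ K, margin A d x * colorSign A x = (K.filter (· ∈ A)).card - A.card := by
  have hcard := Finset.card_filter_add_card_filter_not (s := K) (· ∈ A)
  rw [← Finset.sum_filter_add_sum_filter_not K (· ∈ A)]
  have h1 : ∑ x ∈ K with x ∈ A, margin A d x * colorSign A x =
      A.card * (∑ a ∈ K with a ∈ A, (d a : ℝ)) - A.card * (K.filter (· ∈ A)).card
        + (K.filter (· ∈ A)).card := by
    rw [Finset.sum_congr rfl (g := fun a => (A.card : ℝ) * d a - A.card * 1 + 1)]
    · simp [Finset.sum_add_distrib, Finset.sum_sub_distrib, Finset.mul_sum, mul_comm]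
    · intro x hx
      have := (Finset.mem_filter.1 hx).2
      simp only [margin, colorSign, this, if_true]
      ring
  have h2 : ∑ x ∈ K with x ∉ A, margin A d x * colorSign A x =
      - (A.card * (K.filter (· ∉ A)).card) := by
    rw [Finset.sum_congr rfl (g := fun _ => -(A.card : ℝ))]
    · simp [mul_comm]
    · intro x hx
      have := (Finset.mem_filter.1 hx).2
      simp [margin, colorSign, this]
  rw [h1, h2]
  have e1 : (∑ a ∈ K with a ∈ A, (d a : ℝ)) + 1 =
      (K.filter (· ∈ A)).card + (K.filter (· ∉ A)).card := by
    rw [← hcard] at hK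
    exact_mod_cast hK
  linear_combination (A.card : ℝ) * e1

/-- Shifting the potentials on `K` changes the objective by the signed margin of `K`. -/
lemma dualObjective_add [Fintype W] (K : Finset W) (c : ℝ) (π : W → ℝ) :
    dualObjective A d (fun x => if x ∈ K then π x + c * colorSign A x else π x) =
      dualObjective A d π + c * ∑ x ∈ K, margin A d x * colorSign A x := by
  have hK : ∑ x ∈ K, margin A d x * colorSign A x =
      ∑ x, if x ∈ K then margin A d x * colorSign A x else 0 := by simp
  rw [dualObjective, dualObjective, hK, Finset.mul_sum, ← Finset.sum_add_distrib]
  refine Finset.sum_congr rfl fun x _ => ?_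
  split_ifs <;> ring

/-- The objective of a potential depends only on the tree. -/
lemma IsTree.dualObjective_eq [Fintype W] (hT : T.IsTree) (hA : T.IsBipartiteWith A (A : Set W)ᶜ)
    (hd : ∀ a ∈ A, (T.neighborSet a).ncard = d a) {w : Sym2 W → ℝ} {π π' : W → ℝ}
    (hπ : ∀ a b, T.Adj a b → π a + π b = w s(a, b))
    (hπ' : ∀ a b, T.Adj a b → π' a + π' b = w s(a, b)) :
    dualObjective A d π' = dualObjective A d π := by
  obtain ⟨r⟩ := hT.connected.nonempty
  have hall := hT.connected.forall_of_adj (x₀ := r)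
    (P := fun x => π' x = π x + (π' r - π r) * colorSign A r * colorSign A x) ?_ ?_
  · have heq : π' = fun x => if x ∈ Finset.univ then
        π x + (π' r - π r) * colorSign A r * colorSign A x else π x := by
      funext x
      simpa using hall x
    have hsum : ∑ a ∈ (Finset.univ : Finset W) with a ∈ A, d a + 1 =
        (Finset.univ : Finset W).card := by
      rw [← hT.isAcyclic.sum_ncard_neighborSet_add_one hA (T.connectedComponentMk r)]
      · congr 1
        exact Finset.sum_congr rfl fun a ha => (hd a (Finset.mem_filter.1 ha).2).symm
      · intro x
        simpa using hT.connected.preconnected x r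
    rw [heq, dualObjective_add, sum_margin_mul_colorSign hsum]
    simp
  · simp only [colorSign]
    split_ifs <;> ring
  · intro x y hxy hx
    have h1 := hπ x y hxy
    have h2 := hπ' x y hxy
    have h3 : colorSign A y = - colorSign A x := by
      have := hA.mem_iff_notMem hxy
      by_cases hy : y ∈ A <;> simp_all [colorSign]
    rw [h3]
    linear_combination h2 - h1 - hx

/-- The pivot step of the simplex method: a violated constraint of the dual leads to a tree with
the same degrees on `A` and smaller objective. -/
lemma IsTree.exists_isTree_dualObjective_lt [Fintype W] (hT : T.IsTree)
    (hG : G.IsBipartiteWith A (A : Set W)ᶜ) (hTG : T ≤ G)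
    (hd : ∀ a ∈ A, (T.neighborSet a).ncard = d a) {w : Sym2 W → ℝ} {π : W → ℝ}
    (hπ : ∀ a b, T.Adj a b → π a + π b = w s(a, b)) {e v : W} (he : e ∈ A) (hev : G.Adj e v)
    (hlt : w s(e, v) < π e + π v) :
    ∃ T' ≤ G, T'.IsTree ∧ (∀ a ∈ A, (T'.neighborSet a).ncard = d a) ∧ ∃ π' : W → ℝ,
      (∀ a b, T'.Adj a b → π' a + π' b = w s(a, b)) ∧
        dualObjective A d π' < dualObjective A d π := by
  classical
  have hA := hG.anti hTG
  have hTev : ¬ T.Adj e v := fun h => hlt.ne (hπ e v h).symm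
  have hvA : v ∉ A := (hG.mem_iff_notMem hev).1 he
  obtain ⟨p, hp, -⟩ := hT.existsUnique_path e v
  cases p with
  | nil => exact absurd rfl hev.ne
  | @cons _ u _ heu q =>
  have huA : u ∉ A := (hA.mem_iff_notMem heu).1 he
  have heq : e ∉ q.support := ((Walk.cons_isPath_iff _ _).1 hp).2
  set T₀ := T.deleteEdges {s(e, u)} with hT₀
  have huv : T₀.Reachable u v := reachable_deleteEdges_iff_exists_walk.2
    ⟨q, fun h => heq (q.fst_mem_support_of_mem_edges h)⟩
  have hbr : ¬ T₀.Reachable e u := (isAcyclic_iff_forall_adj_isBridge.1 hT.isAcyclic) heu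
  have hT₀T : T₀ ≤ T := deleteEdges_le _
  have hT₀adj : ∀ {x y}, T₀.Adj x y ↔ T.Adj x y ∧ s(x, y) ≠ s(e, u) := by
    intro x y
    simp [hT₀, deleteEdges_adj]
  let K : Finset W := Finset.univ.filter fun x => T₀.Reachable x u
  have hKmem : ∀ x, x ∈ K ↔ T₀.Reachable x u := fun x => by simp [K]
  have heK : e ∉ K := by simpa [hKmem] using hbr
  have hvK : v ∈ K := by simpa [hKmem] using huv.symm
  have hKadj : ∀ {x y}, T₀.Adj x y → (x ∈ K ↔ y ∈ K) := fun h => by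
    rw [hKmem, hKmem]
    exact ⟨fun h' => h.reachable.symm.trans h', fun h' => h.reachable.trans h'⟩
  have hdeg₀ : ∀ a ∈ A, a ≠ e → T₀.neighborSet a = T.neighborSet a := by
    intro a ha hae
    ext y
    simp only [mem_neighborSet, hT₀adj, and_iff_left_iff_imp]
    rintro - h
    rcases Sym2.eq_iff.1 h with ⟨rfl, -⟩ | ⟨rfl, -⟩
    · exact hae rfl
    · exact huA ha
  have hsum : ∑ a ∈ K with a ∈ A, d a + 1 = K.card := by
    rw [← (hT.isAcyclic.anti hT₀T).sum_ncard_neighborSet_add_one (hA.anti hT₀T)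
      (T₀.connectedComponentMk u) (by simpa using hKmem)]
    congr 1
    refine Finset.sum_congr rfl fun a ha => ?_
    obtain ⟨haK, ha⟩ := Finset.mem_filter.1 ha
    rw [hdeg₀ a ha (by rintro rfl; exact heK haK), hd a ha]
  have hlt' : ∑ x ∈ K, margin A d x * colorSign A x < 0 := by
    rw [sum_margin_mul_colorSign hsum, sub_neg, Nat.cast_lt]
    refine Finset.card_lt_card ⟨fun x hx => (Finset.mem_filter.1 hx).2, fun h => heK ?_⟩
    exact (Finset.mem_filter.1 (h he)).1
  have hT'adj : ∀ {x y}, (T₀ ⊔ edge e v).Adj x y ↔ T₀.Adj x y ∨ s(x, y) = s(e, v) := by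
    intro x y
    rw [sup_adj, edge_adj, Sym2.eq_iff]
    constructor
    · tauto
    · rintro (h | h)
      · exact Or.inl h
      · refine Or.inr ⟨by tauto, ?_⟩
        rcases h with ⟨rfl, rfl⟩ | ⟨rfl, rfl⟩
        exacts [hev.ne, hev.ne']
  refine ⟨T₀ ⊔ edge e v, ?_, hT.isTree_deleteEdges_sup_edge heu hev.ne huv, ?_,
    fun x => if x ∈ K then π x + (π e + π v - w s(e, v)) * colorSign A x else π x, ?_, ?_⟩
  · intro x y h
    rcases hT'adj.1 h with h | h
    · exact hTG (hT₀T h)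
    · rwa [← mem_edgeSet, h, mem_edgeSet]
  · intro a ha
    rw [← hd a ha]
    by_cases hae : a = e
    · subst hae
      rw [← Set.ncard_exchange (s := T.neighborSet a) (a := v) (b := u) hTev heu]
      congr 1
      ext y
      simp only [mem_neighborSet, hT'adj, hT₀adj, Set.mem_insert_iff, Set.mem_sdiff,
        Set.mem_singleton_iff, Sym2.congr_right, ne_eq]
      tauto
    · rw [← hdeg₀ a ha hae]
      congr 1
      ext y
      simp only [mem_neighborSet, hT'adj, or_iff_left_iff_imp]
      intro h
      rcases Sym2.eq_iff.1 h with ⟨rfl, -⟩ | ⟨rfl, -⟩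
      · exact absurd rfl hae
      · exact absurd ha hvA
  · have hev' : ((if e ∈ K then π e + (π e + π v - w s(e, v)) * colorSign A e else π e) +
        if v ∈ K then π v + (π e + π v - w s(e, v)) * colorSign A v else π v) = w s(e, v) := by
      simp only [heK, hvK, if_true, if_false, colorSign, hvA]
      ring
    intro x y h
    rcases hT'adj.1 h with h | h
    · rw [← hπ x y (hT₀T h)]
      have h3 : colorSign A y = - colorSign A x := by
        have := hA.mem_iff_notMem (hT₀T h)
        by_cases hy : y ∈ A <;> simp_all [colorSign]
      by_cases hx : x ∈ K
      · simp only [hx, (hKadj h).1 hx, if_true, h3]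
        ring
      · simp only [hx, mt (hKadj h).2 hx, if_false]
    · rcases Sym2.eq_iff.1 h with ⟨rfl, rfl⟩ | ⟨rfl, rfl⟩
      · exact hev'
      · rw [add_comm, Sym2.eq_swap (a := x)]
        exact hev'
  · rw [dualObjective_add]
    have := mul_neg_of_pos_of_neg (sub_pos.2 hlt) hlt'
    linarith

end Objective

/-- Every degree vector on `A` of a spanning tree is realised by a tight tree. -/
lemma exists_isTightTree [Finite W] {w : Sym2 W → ℝ} (hw : LinearIndependent ℚ w)
    (hG : G.IsBipartiteWith A (A : Set W)ᶜ) (hTG : T ≤ G) (hT : T.IsTree) :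
    ∃ T', G.IsTightTree w T' ∧
      ∀ a ∈ A, (T'.neighborSet a).ncard = (T.neighborSet a).ncard := by
  classical
  have := Fintype.ofFinite W
  set d : W → ℕ := fun a => (T.neighborSet a).ncard
  let X := {S : SimpleGraph W // S ≤ G ∧ S.IsTree ∧ ∀ a ∈ A, (S.neighborSet a).ncard = d a}
  choose π hπ using fun S : X => S.2.2.1.exists_potential w
  have : Nonempty X := ⟨⟨T, hTG, hT, fun _ _ => rfl⟩⟩
  obtain ⟨S, hS⟩ := Finite.exists_min fun S : X => dualObjective A d (π S)
  obtain ⟨hSG, hStree, hSd⟩ := S.2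
  have hfeas : ∀ a b, a ∈ A → G.Adj a b → π S a + π S b ≤ w s(a, b) := by
    intro a b ha hab
    by_contra! hlt
    obtain ⟨S', hS'G, hS'tree, hS'd, π', hπ', hobj⟩ :=
      hStree.exists_isTree_dualObjective_lt hG hSG hSd (hπ S) ha hab hlt
    have h1 := hS ⟨S', hS'G, hS'tree, hS'd⟩
    have h2 := hS'tree.dualObjective_eq (hG.anti hS'G) hS'd hπ' (hπ ⟨S', hS'G, hS'tree, hS'd⟩)
    linarith
  have key : ∀ a b, a ∈ A → G.Adj a b → π S a + π S b ≤ w s(a, b) ∧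
      (π S a + π S b = w s(a, b) ↔ S.1.Adj a b) := fun a b ha hab =>
    ⟨hfeas a b ha hab, fun h => hStree.connected.adj_of_potential_eq (hG.anti hSG) hw (hπ S) ha
      ((hG.mem_iff_notMem hab).1 ha) h, hπ S a b⟩
  refine ⟨S, ⟨hSG, hStree, π S, fun a b hab => ?_⟩, hSd⟩
  by_cases ha : a ∈ A
  · exact key a b ha hab
  · rw [add_comm, Sym2.eq_swap, S.1.adj_comm]
    exact key b a ((hG.mem_iff_notMem hab.symm).2 ha) hab.symm

/-- The degree vectors, on a color class `A` parametrised by `i`, of spanning trees of `G` are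
equinumerous with the tight trees. -/
lemma ncard_degreeVectors_eq_ncard_isTightTree [Finite W] [Nontrivial W] {ι : Type*}
    {w : Sym2 W → ℝ} (hw : LinearIndependent ℚ w) (hG : G.IsBipartiteWith A (A : Set W)ᶜ)
    (i : ι → W) (hi : ∀ x, x ∈ A ↔ ∃ k, i k = x) :
    {f : ι → ℕ | ∃ T ≤ G, T.IsTree ∧ ∀ k, (T.neighborSet (i k)).ncard = f k + 1}.ncard =
      {T | G.IsTightTree w T}.ncard := by
  have hpos : ∀ {T : SimpleGraph W}, T.IsTree → ∀ x, (T.neighborSet x).ncard ≠ 0 := by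
    intro T hT x h
    obtain ⟨y, hy⟩ := hT.connected.preconnected.exists_adj_of_nontrivial x
    rw [Set.ncard_eq_zero] at h
    exact (h ▸ (show y ∈ T.neighborSet x from hy) : y ∈ (∅ : Set W))
  have hinj : Set.InjOn (fun T : SimpleGraph W => fun k => (T.neighborSet (i k)).ncard - 1)
      {T | G.IsTightTree w T} := by
    intro T hT T' hT' h
    refine hT.eq_of_ncard_neighborSet_eq hG hT' fun a ha => ?_
    obtain ⟨k, rfl⟩ := (hi a).1 ha
    have h1 : (T.neighborSet (i k)).ncard - 1 = (T'.neighborSet (i k)).ncard - 1 := congrFun h k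
    have h2 := hpos hT.2.1 (i k)
    have h3 := hpos hT'.2.1 (i k)
    omega
  rw [← hinj.ncard_image]
  congr 1
  ext f
  constructor
  · rintro ⟨T, hTG, hT, hf⟩
    obtain ⟨T', hT', hd⟩ := exists_isTightTree hw hG hTG hT
    refine ⟨T', hT', funext fun k => ?_⟩
    have := hd (i k) ((hi _).2 ⟨k, rfl⟩)
    have := hf k
    dsimp only
    omega
  · rintro ⟨T, hT, rfl⟩
    refine ⟨T, hT.1, hT.2.1, fun k => ?_⟩
    have := hpos hT.2.1 (i k)
    dsimp only
    omega

end SimpleGraph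

/-- Every finite type indexes a family of rationally independent real numbers. -/
lemma exists_linearIndependent_rat_real (ι : Type*) [Finite ι] :
    ∃ w : ι → ℝ, LinearIndependent ℚ w := by
  have := Fintype.ofFinite ι
  obtain ⟨f, hf⟩ := exists_linearIndependent_of_le_rank (R := ℚ) (M := ℝ)
    (n := Fintype.card ι) (by
      rw [Real.rank_rat_real]
      exact (Cardinal.natCast_lt_aleph0.trans_le Cardinal.aleph0_le_continuum).le)
  exact ⟨f ∘ Fintype.equivFin ι, hf.comp _ (Fintype.equivFin ι).injective⟩

lemma isLeft_eq_not_isLeft_of_bip_adj {V E : Type*} (I : E → Finset V) {a b : E ⊕ V}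
    (h : (bip I).Adj a b) :
    a.isLeft = !b.isLeft := by
  rw [bip, fromRel_adj] at h
  rcases h with ⟨-, ⟨e, v, rfl, rfl, -⟩ | ⟨e, v, rfl, rfl, -⟩⟩ <;> rfl

/-- A connected bipartite graph `G` with color classes `V` and `E` induces the
hypergraph `(V, E)` and its abstract dual `(E, V)`; these have the same number
of hypertrees. -/
theorem card_hypertrees_eq_card_hypertrees_dual {V E : Type*}
    [Fintype V] [Fintype E] (I : E → Finset V)
    (hne : ∀ e, (I e).Nonempty) (hne' : ∀ v, ∃ e, v ∈ I e)
    (hconn : (bip I).Connected) :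
    {f : E → ℕ | IsHypertree I f}.ncard =
      {g : V → ℕ | IsHypertreeDual I g}.ncard := by
  classical
  obtain ⟨w, hw⟩ := exists_linearIndependent_rat_real (Sym2 (E ⊕ V))
  have : Nontrivial (E ⊕ V) := by
    obtain ⟨x⟩ := hconn.nonempty
    obtain ⟨e, v⟩ : Nonempty (E × V) := by
      rcases x with e | v
      · exact ⟨e, (hne e).choose⟩
      · exact ⟨(hne' v).choose, v⟩
    exact ⟨Sum.inl e, Sum.inr v, by simp⟩
  refine (ncard_degreeVectors_eq_ncard_isTightTree (A := Finset.univ.filter (·.isLeft)) hw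
    ⟨disjoint_compl_right, fun a b h => ?_⟩ Sum.inl ?_).trans
    (ncard_degreeVectors_eq_ncard_isTightTree (A := Finset.univ.filter (·.isRight)) hw
    ⟨disjoint_compl_right, fun a b h => ?_⟩ Sum.inr ?_).symm
  · have := isLeft_eq_not_isLeft_of_bip_adj I h
    rcases a with a | a <;> rcases b with b | b <;> simp_all
  · rintro (x | x) <;> simp
  · have := isLeft_eq_not_isLeft_of_bip_adj I h
    rcases a with a | a <;> rcases b with b | b <;> simp_all
  · rintro (x | x) <;> simp
end
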